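/- arXiv:2604.16805 — 2 statements merged into one kernel-verified Lean document; each statement's English description precedes it below -/
import Mathlib

section
/- Let k be a field and A a ℤ-graded k-algebra. Let (X^n, d_X^n : X^n → X^{n+1})_{n∈ℤ} and (Y^n, d_Y^n : Y^n → Y^{n+1})_{n∈ℤ} be cochain complexes of A-modules in which every term carries the structure of a graded A-module, and suppose that for every n ∈ ℤ the module X^n is generated as an A-module by its homogeneous component of degree −n, while (Y^n)_j = 0 for all j < −n. Then every family h = (h^n : X^n → Y^{n−1})_{n∈ℤ} of degree-preserving A-linear maps vanishes identically: h^n = 0 for all n. Consequently, if f, g : X → Y are cochain maps with degree-preserving components such that f^n − g^n = d_Y^{n−1} ∘ h^n + h^{n+1} ∘ d_X^n for all n (i.e. f and g are homotopic via a degree-preserving homotopy h), then f = g; every null-homotopic degree-preserving morphism between such linear complexes is zero. -/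
/-- Let `X`, `Y` be cochain complexes of graded `A`-modules such that
`X^n` is generated by its component of degree `−n` and `(Y^n)_j = 0` for `j < −n`.
Then every family of degree-preserving `A`-linear maps `h^{n+1} : X^{n+1} → Y^n`
vanishes; consequently two cochain maps with degree-preserving components that are
homotopic via a degree-preserving homotopy are equal.  (Here `h n : X (n+1) →ₗ[A] Y n`
plays the role of `h^{n+1}`.) -/
theorem stmt_5 (k A : Type*) [Field k] [Ring A] [Algebra k A]
    (𝒜 : ℤ → Submodule k A) [GradedAlgebra 𝒜]
    (X Y : ℤ → Type*)
    [∀ n, AddCommGroup (X n)] [∀ n, Module k (X n)] [∀ n, Module A (X n)]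
    [∀ n, IsScalarTower k A (X n)]
    [∀ n, AddCommGroup (Y n)] [∀ n, Module k (Y n)] [∀ n, Module A (Y n)]
    [∀ n, IsScalarTower k A (Y n)]
    (𝒳 : ∀ n : ℤ, ℤ → Submodule k (X n)) (𝒴 : ∀ n : ℤ, ℤ → Submodule k (Y n))
    [∀ n, DirectSum.Decomposition (𝒳 n)] [∀ n, DirectSum.Decomposition (𝒴 n)]
    [∀ n, SetLike.GradedSMul 𝒜 (𝒳 n)] [∀ n, SetLike.GradedSMul 𝒜 (𝒴 n)]
    (dX : ∀ n : ℤ, X n →ₗ[A] X (n + 1)) (dY : ∀ n : ℤ, Y n →ₗ[A] Y (n + 1))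
    (hdX : ∀ n : ℤ, (dX (n + 1)).comp (dX n) = 0)
    (hdY : ∀ n : ℤ, (dY (n + 1)).comp (dY n) = 0)
    (hgen : ∀ n : ℤ, Submodule.span A ((𝒳 n (-n) : Set (X n))) = ⊤)
    (hvan : ∀ n j : ℤ, j < -n → 𝒴 n j = ⊥)
    (h : ∀ n : ℤ, X (n + 1) →ₗ[A] Y n)
    (hh : ∀ n j : ℤ, ∀ x ∈ 𝒳 (n + 1) j, h n x ∈ 𝒴 n j) :
    (∀ n : ℤ, h n = 0) ∧
    (∀ f g : ∀ n : ℤ, X n →ₗ[A] Y n,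
      (∀ n j : ℤ, ∀ x ∈ 𝒳 n j, f n x ∈ 𝒴 n j) →
      (∀ n j : ℤ, ∀ x ∈ 𝒳 n j, g n x ∈ 𝒴 n j) →
      (∀ n : ℤ, (dY n).comp (f n) = (f (n + 1)).comp (dX n)) →
      (∀ n : ℤ, (dY n).comp (g n) = (g (n + 1)).comp (dX n)) →
      (∀ n : ℤ, f (n + 1) - g (n + 1) =
        (dY n).comp (h n) + (h (n + 1)).comp (dX (n + 1))) →
      ∀ n : ℤ, f n = g n) := by
  have hzero : ∀ n : ℤ, h n = 0 := fun n =>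
    LinearMap.ext_on (hgen (n + 1)) fun x hx => by
      have hmem := hh n _ x hx
      rw [hvan n (-(n + 1)) (by omega)] at hmem
      simpa using hmem
  refine ⟨hzero, fun f g _ _ _ _ hfg n => ?_⟩
  obtain ⟨m, rfl⟩ : ∃ m : ℤ, n = m + 1 := ⟨n - 1, by omega⟩
  simpa [hzero, sub_eq_zero] using hfg m
end

section
/- Let k be a field and A a ℤ-graded k-algebra. Let (P^i)_{i∈ℤ} be a family of graded A-modules, each finite-dimensional as a k-vector space, and let (Y^j)_{j∈ℤ} be a family of graded A-modules such that Y^j = 0 for all but finitely many j ∈ ℤ. Fix n ∈ ℤ. Then the canonical k-linear map ⊕_{m∈ℤ} ∏_{i∈ℤ} Hom_A^{(m)}(P^i, Y^{i+n}) → ∏_{i∈ℤ} Hom_A(P^i, Y^{i+n}), which sends a finitely supported family ((f_{m,i})_{i∈ℤ})_{m∈ℤ} of families of homogeneous maps of degree m to the family (Σ_m f_{m,i})_{i∈ℤ}, is bijective. (This is the degreewise form of the isomorphism Hom_{C_dg(A-mod)}(P•, Y•) ≅ ⊕_{m∈ℤ} Hom_{C_dg(A-gmod)}(P•, Y•⟨m⟩)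 established in the proof of Theorem 4.1 of the paper, for a bounded-above complex P• of finite-dimensional graded modules and a bounded complex Y•.) -/
namespace GradedHom

open DirectSum

section Projection

variable {k N : Type*} [Field k] [AddCommGroup N] [Module k N]
  (Ngr : ℤ → Submodule k N) [Decomposition Ngr]

/-- The projection of a graded module onto its component of degree `l`. -/
def proj (l : ℤ) : N →ₗ[k] N :=
  (Ngr l).subtype ∘ₗ DirectSum.component k ℤ (fun j => Ngr j) l ∘ₗ
    (decomposeLinearEquiv Ngr).toLinearMap

theorem proj_apply (l : ℤ) (x : N) : proj Ngr l x = decompose Ngr x l := rfl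

theorem proj_mem (l : ℤ) (x : N) : proj Ngr l x ∈ Ngr l := (decompose Ngr x l).2

variable {Ngr} in
theorem proj_of_mem {l : ℤ} (j : ℤ) {x : N} (hx : x ∈ Ngr l) :
    proj Ngr j x = if j = l then x else 0 := by
  rw [proj_apply]
  split_ifs with h
  · subst h
    exact decompose_of_mem_same Ngr hx
  · exact decompose_of_mem_ne Ngr hx (Ne.symm h)

theorem ext_proj {x y : N} (h : ∀ l, proj Ngr l x = proj Ngr l y) : x = y := by
  apply (decompose Ngr).injective
  ext l
  exact h l

theorem finite_proj_ne_zero (x : N) : {l | proj Ngr l x ≠ 0}.Finite := by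
  classical
  refine (decompose Ngr x).support.finite_toSet.subset fun l hl => ?_
  simpa [proj_apply] using hl

theorem mem_of_forall_le {S : Submodule k N} (h : ∀ j, Ngr j ≤ S) (x : N) : x ∈ S := by
  induction x using Decomposition.inductionOn Ngr with
  | zero => exact S.zero_mem
  | homogeneous m => exact h _ m.2
  | add a b ha hb => exact S.add_mem ha hb

theorem proj_smul {A : Type*} [Ring A] [Algebra k A] (𝒜 : ℤ → Submodule k A)
    [Module A N] [SetLike.GradedSMul 𝒜 Ngr] {d : ℤ} {a : A} (ha : a ∈ 𝒜 d) (l : ℤ) (x : N) :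
    proj Ngr (d + l) (a • x) = a • proj Ngr l x := by
  induction x using Decomposition.inductionOn Ngr with
  | zero => simp
  | @homogeneous j x =>
    have h : a • (x : N) ∈ Ngr (d + j) := SetLike.GradedSMul.smul_mem ha x.2
    rw [proj_of_mem _ h, proj_of_mem _ x.2]
    simp
  | add x y hx hy => simp only [smul_add, map_add, hx, hy]

end Projection

variable {k A : Type*} [Field k] [Ring A] [Algebra k A]
  {M N : Type*} [AddCommGroup M] [Module k M] [Module A M] [IsScalarTower k A M]
  [AddCommGroup N] [Module k N] [Module A N] [IsScalarTower k A N]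
  (Mgr : ℤ → Submodule k M) (Ngr : ℤ → Submodule k N)
  [Decomposition Mgr] [Decomposition Ngr]

/-- The homogeneous component of degree `m` of a linear map, as a `k`-linear map. -/
def linearComponent (m : ℤ) (f : M →ₗ[k] N) : M →ₗ[k] N :=
  DirectSum.toModule k ℤ N (fun j => proj Ngr (j + m) ∘ₗ f ∘ₗ (Mgr j).subtype) ∘ₗ
    (decomposeLinearEquiv Mgr).toLinearMap

variable {Mgr} in
theorem linearComponent_of_mem (m : ℤ) (f : M →ₗ[k] N) {j : ℤ} {x : M} (hx : x ∈ Mgr j) :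
    linearComponent Mgr Ngr m f x = proj Ngr (j + m) (f x) := by
  lift x to Mgr j using hx
  simp [linearComponent]

theorem linearComponent_smul (𝒜 : ℤ → Submodule k A) [GradedAlgebra 𝒜]
    [SetLike.GradedSMul 𝒜 Mgr] [SetLike.GradedSMul 𝒜 Ngr] (m : ℤ) (f : M →ₗ[A] N) (a : A) (x : M) :
    linearComponent Mgr Ngr m (f.restrictScalars k) (a • x) =
      a • linearComponent Mgr Ngr m (f.restrictScalars k) x := by
  induction a using Decomposition.inductionOn 𝒜 with
  | zero => simp
  | add a b ha hb => simp only [add_smul, map_add, ha, hb]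
  | @homogeneous d a =>
    induction x using Decomposition.inductionOn Mgr with
    | zero => simp
    | add x y hx hy => simp only [smul_add, map_add, hx, hy]
    | @homogeneous j x =>
      have h : (a : A) • (x : M) ∈ Mgr (d + j) := SetLike.GradedSMul.smul_mem a.2 x.2
      rw [linearComponent_of_mem _ _ _ h, linearComponent_of_mem _ _ _ x.2, add_assoc]
      simp [proj_smul Ngr 𝒜 a.2]

variable (𝒜 : ℤ → Submodule k A) [GradedAlgebra 𝒜]
  [SetLike.GradedSMul 𝒜 Mgr] [SetLike.GradedSMul 𝒜 Ngr]

/-- The homogeneous component of degree `m` of an `A`-linear map. -/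
def component (m : ℤ) (f : M →ₗ[A] N) : M →ₗ[A] N where
  toFun := linearComponent Mgr Ngr m (f.restrictScalars k)
  map_add' := map_add _
  map_smul' := linearComponent_smul Mgr Ngr 𝒜 m f

variable {Mgr} in
theorem component_of_mem (m : ℤ) (f : M →ₗ[A] N) {j : ℤ} {x : M} (hx : x ∈ Mgr j) :
    component Mgr Ngr 𝒜 m f x = proj Ngr (j + m) (f x) :=
  linearComponent_of_mem Ngr m (f.restrictScalars k) hx

theorem ext_homogeneous {f g : M →ₗ[A] N} (h : ∀ j, ∀ x ∈ Mgr j, f x = g x) : f = g := by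
  ext x
  exact mem_of_forall_le Mgr
    (S := LinearMap.eqLocus (f.restrictScalars k) (g.restrictScalars k)) h x

theorem finite_component_ne_zero [FiniteDimensional k M] (f : M →ₗ[A] N) :
    {m | component Mgr Ngr 𝒜 m f ≠ 0}.Finite := by
  have hfin (x : M) : {m | component Mgr Ngr 𝒜 m f x ≠ 0}.Finite := by
    induction x using Decomposition.inductionOn Mgr with
    | zero => simp
    | @homogeneous j x =>
      simp only [component_of_mem Ngr 𝒜 _ f x.2]
      exact (finite_proj_ne_zero Ngr (f x)).preimage (add_right_injective j).injOn
    | add x y hx hy =>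
      refine (hx.union hy).subset fun m hm => ?_
      by_contra h
      simp_all
  let b := Module.finBasis k M
  refine (Set.finite_iUnion fun i => hfin (b i)).subset fun m hm => ?_
  by_contra h
  simp only [Set.mem_iUnion, Set.mem_ofPred_eq, not_exists, not_not] at h
  refine hm (LinearMap.restrictScalars_injective k (b.ext fun i => ?_))
  simpa using h i

theorem sum_component {s : Finset ℤ} (f : M →ₗ[A] N)
    (hs : ∀ m ∉ s, component Mgr Ngr 𝒜 m f = 0) :
    ∑ m ∈ s, component Mgr Ngr 𝒜 m f = f := by
  refine ext_homogeneous Mgr fun j x hx => ext_proj Ngr fun l => ?_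
  have hl (m : ℤ) : l = j + m ↔ l - j = m := by omega
  simp only [LinearMap.sum_apply, component_of_mem Ngr 𝒜 _ f hx, map_sum,
    proj_of_mem _ (proj_mem Ngr _ _), hl, Finset.sum_ite_eq]
  split_ifs with h
  · simp
  · have h0 := component_of_mem Ngr 𝒜 (l - j) f hx
    rw [hs _ h] at h0
    simpa using h0

theorem component_sum {s : Finset ℤ} (F : ℤ → M →ₗ[A] N)
    (hF : ∀ m j, ∀ x ∈ Mgr j, F m x ∈ Ngr (j + m)) (hs : ∀ m ∉ s, F m = 0) (m : ℤ) :
    component Mgr Ngr 𝒜 m (∑ i ∈ s, F i) = F m := by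
  refine ext_homogeneous Mgr fun j x hx => ?_
  rw [component_of_mem Ngr 𝒜 m _ hx, LinearMap.sum_apply, map_sum,
    Finset.sum_congr rfl fun i _ => proj_of_mem (j + m) (hF i j x hx)]
  simp only [add_right_inj, Finset.sum_ite_eq]
  split_ifs with h
  · rfl
  · simp [hs m h]

end GradedHom

open GradedHom

/-- Let `(P^i)` be a family of graded `A`-modules, each
finite-dimensional over `k`, and `(Y^j)` a family of graded `A`-modules with `Y^j = 0`
for all but finitely many `j`.  Fix `n`.  Then the canonical map
`⊕_m ∏_i Hom_A^{(m)}(P^i, Y^{i+n}) → ∏_i Hom_A(P^i, Y^{i+n})`, sending a finitely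
supported family of families of homogeneous maps of degree `m` to the family of its
sums, is bijective. -/
theorem stmt_6 (k A : Type*) [Field k] [Ring A] [Algebra k A]
    (𝒜 : ℤ → Submodule k A) [GradedAlgebra 𝒜]
    (P Y : ℤ → Type*)
    [∀ i, AddCommGroup (P i)] [∀ i, Module k (P i)] [∀ i, Module A (P i)]
    [∀ i, IsScalarTower k A (P i)]
    [∀ j, AddCommGroup (Y j)] [∀ j, Module k (Y j)] [∀ j, Module A (Y j)]
    [∀ j, IsScalarTower k A (Y j)]
    (Pgr : ∀ i : ℤ, ℤ → Submodule k (P i)) (Ygr : ∀ j : ℤ, ℤ → Submodule k (Y j))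
    [∀ i, DirectSum.Decomposition (Pgr i)] [∀ j, DirectSum.Decomposition (Ygr j)]
    [∀ i, SetLike.GradedSMul 𝒜 (Pgr i)] [∀ j, SetLike.GradedSMul 𝒜 (Ygr j)]
    [∀ i, FiniteDimensional k (P i)]
    (hY : {j : ℤ | ∃ y : Y j, y ≠ 0}.Finite)
    (n : ℤ) :
    Function.Bijective
      (fun F : {F : ℤ →₀ (∀ i : ℤ, P i →ₗ[A] Y (i + n)) //
          ∀ (m i j : ℤ), ∀ x ∈ Pgr i j, F m i x ∈ Ygr (i + n) (j + m)} =>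
        fun i : ℤ => F.1.sum fun _ g => g i) := by
  constructor
  · have key (F : {F : ℤ →₀ (∀ i : ℤ, P i →ₗ[A] Y (i + n)) //
        ∀ (m i j : ℤ), ∀ x ∈ Pgr i j, F m i x ∈ Ygr (i + n) (j + m)}) (m i : ℤ) :
        component (Pgr i) (Ygr (i + n)) 𝒜 m (F.1.sum fun _ g => g i) = F.1 m i :=
      component_sum (Pgr i) (Ygr (i + n)) 𝒜 (fun m => F.1 m i) (fun m j => F.2 m i j)
        (fun m hm => by simp [Finsupp.notMem_support_iff.mp hm]) m
    intro F G h
    refine Subtype.ext (Finsupp.ext fun m => funext fun i => ?_)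
    rw [← key F, ← key G]
    exact congrArg _ (congrFun h i)
  · intro f
    have hfin : {m | (fun i => component (Pgr i) (Ygr (i + n)) 𝒜 m (f i)) ≠ 0}.Finite := by
      refine ((hY.preimage (add_left_injective n).injOn).biUnion fun i _ =>
        finite_component_ne_zero (Pgr i) (Ygr (i + n)) 𝒜 (f i)).subset fun m hm => ?_
      obtain ⟨i, hi⟩ := Function.ne_iff.mp hm
      obtain ⟨x, hx⟩ := DFunLike.ne_iff.mp hi
      exact Set.mem_biUnion (x := i) ⟨_, hx⟩ hi
    let F : ℤ →₀ (∀ i : ℤ, P i →ₗ[A] Y (i + n)) :=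
      Finsupp.ofSupportFinite (fun m i => component (Pgr i) (Ygr (i + n)) 𝒜 m (f i)) hfin
    refine ⟨⟨F, fun m i j x hx => ?_⟩, funext fun i => ?_⟩
    · change component (Pgr i) (Ygr (i + n)) 𝒜 m (f i) x ∈ _
      rw [component_of_mem _ 𝒜 m _ hx]
      exact proj_mem _ _ _
    · exact sum_component (Pgr i) (Ygr (i + n)) 𝒜 (f i) fun m hm =>
        congrFun (Finsupp.notMem_support_iff.mp hm) i
end
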